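/- arXiv:2004.03204 — 9 statements merged into one kernel-verified Lean document; each statement's English description precedes it below -/
import Mathlib

section
/- Let p, q be real numbers with 1 < q < p ≤ 3 and let N ≥ 1 be an integer. Then there exists a constant C > 0 (depending only on p, q, N) such that for all (s_1, …, s_N) ∈ ℝ^N one has |f'(∑_{n=1}^N s_n) − ∑_{n=1}^N f'(s_n)| ≤ C ( ∑_{n ≠ n'} |s_n|^{(q−1)/2} |s_{n'}|^{(q−1)/2} + ∑_{n ≠ n'} |s_n|^{(p−1)/2} |s_{n'}|^{(p−1)/2} ), where the sums ∑_{n ≠ n'} run over ordered pairs (n, n') with 1 ≤ n, n' ≤ N and n ≠ n'. -/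
/-- Derivative of the double power nonlinearity `f(s) = |s|^(p-1) s - |s|^(q-1) s`:
`f'(s) = p |s|^(p-1) - q |s|^(q-1)` (real exponents). -/
noncomputable def fD' (p q s : ℝ) : ℝ := p * |s| ^ (p - 1) - q * |s| ^ (q - 1)

/-- The off-diagonal part of the square of a finite sum. -/
theorem sum_offDiag_mul_eq_sq_sub {N : ℕ} (x : Fin N → ℝ) :
    (∑ n, ∑ n', if n = n' then 0 else x n * x n') = (∑ n, x n) ^ 2 - ∑ n, x n ^ 2 := by
  have h : ∀ n, (∑ n', if n = n' then 0 else x n * x n') = x n * ∑ n', x n' - x n ^ 2 := by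
    intro n
    have h' : ∀ n', (if n = n' then 0 else x n * x n') =
        x n * x n' - if n = n' then x n * x n' else 0 := by
      intro n'; split_ifs <;> simp
    simp only [h', Finset.sum_sub_distrib, Finset.sum_ite_eq, Finset.mem_univ, if_true,
      Finset.mul_sum, sq]
  simp only [h, Finset.sum_sub_distrib, ← Finset.sum_mul, sq]

/-- Subadditivity of `|·| ^ b` for `0 < b ≤ 1`. -/
theorem abs_sum_rpow_le_sum_abs_rpow {ι : Type*} {b : ℝ} (hb : 0 < b) (hb1 : b ≤ 1)
    (t : Finset ι) (s : ι → ℝ) : |∑ n ∈ t, s n| ^ b ≤ ∑ n ∈ t, |s n| ^ b := by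
  refine Finset.le_sum_of_subadditive (fun u : ℝ => |u| ^ b) (by simp [hb.ne']) (fun u v => ?_) t s
  exact (Real.rpow_le_rpow (abs_nonneg _) (abs_add_le u v) hb.le).trans
    (Real.rpow_add_le_add_rpow (abs_nonneg _) (abs_nonneg _) hb.le hb1)

/-- For `0 < α ≤ 2`, the defect of additivity of `|·| ^ α` is controlled by the
off-diagonal products of `|·| ^ (α / 2)`. -/
theorem abs_abs_sum_rpow_sub_sum_le {α : ℝ} (hα : 0 < α) (hα2 : α ≤ 2) {N : ℕ} (hN : 1 ≤ N)
    (s : Fin N → ℝ) :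
    |(|∑ n, s n| ^ α - ∑ n, |s n| ^ α)| ≤
      3 * ∑ n, ∑ n', if n = n' then 0 else |s n| ^ (α / 2) * |s n'| ^ (α / 2) := by
  have hb : 0 < α / 2 := by linarith
  have hb1 : α / 2 ≤ 1 := by linarith
  have hsq : ∀ u : ℝ, |u| ^ α = (|u| ^ (α / 2)) ^ 2 := fun u => by
    rw [← Real.rpow_mul_natCast (abs_nonneg u)]; norm_num
  rw [sum_offDiag_mul_eq_sq_sub (fun n => |s n| ^ (α / 2))]
  simp only [hsq]
  have : Nonempty (Fin N) := ⟨⟨0, hN⟩⟩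
  obtain ⟨m, hm⟩ := Finite.exists_max (fun n => |s n| ^ (α / 2))
  have hx : ∀ n, 0 ≤ |s n| ^ (α / 2) := fun n => Real.rpow_nonneg (abs_nonneg _) _
  have hy : 0 ≤ |∑ n, s n| ^ (α / 2) := Real.rpow_nonneg (abs_nonneg _) _
  have hyT := abs_sum_rpow_le_sum_abs_rpow hb hb1 Finset.univ s
  have hQ : ∑ n, (|s n| ^ (α / 2)) ^ 2 ≤ |s m| ^ (α / 2) * ∑ n, |s n| ^ (α / 2) := by
    rw [Finset.mul_sum]
    refine Finset.sum_le_sum fun n _ => ?_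
    rw [sq]
    exact mul_le_mul_of_nonneg_right (hm n) (hx n)
  have hMT : |s m| ^ (α / 2) ≤ ∑ n, |s n| ^ (α / 2) :=
    Finset.single_le_sum (fun n _ => hx n) (Finset.mem_univ m)
  have hlow : |s m| ^ (α / 2) ≤
      |∑ n, s n| ^ (α / 2) + (∑ n, |s n| ^ (α / 2) - |s m| ^ (α / 2)) := by
    have hrest := abs_sum_rpow_le_sum_abs_rpow hb hb1 (Finset.univ.erase m) s
    have e1 := Finset.add_sum_erase Finset.univ s (Finset.mem_univ m)
    have e2 := Finset.add_sum_erase Finset.univ (fun n => |s n| ^ (α / 2)) (Finset.mem_univ m)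
    have htri : |s m| ≤ |∑ n, s n| + |∑ n ∈ Finset.univ.erase m, s n| := by
      rw [← e1]
      simpa using abs_sub (s m + ∑ n ∈ Finset.univ.erase m, s n) (∑ n ∈ Finset.univ.erase m, s n)
    have := (Real.rpow_le_rpow (abs_nonneg _) htri hb.le).trans
      (Real.rpow_add_le_add_rpow (abs_nonneg _) (abs_nonneg _) hb.le hb1)
    linarith
  have hM := hx m
  generalize |s m| ^ (α / 2) = M at *
  generalize |∑ n, s n| ^ (α / 2) = y at *
  generalize ∑ n, |s n| ^ (α / 2) = T at *
  generalize ∑ n, (|s n| ^ (α / 2)) ^ 2 = Q at *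
  have hQT : Q ≤ T ^ 2 := by nlinarith
  rw [abs_le]
  constructor
  · rcases le_total T (2 * M) with h | h
    · have : (2 * M - T) ^ 2 ≤ y ^ 2 := pow_le_pow_left₀ (by linarith) (by linarith) 2
      nlinarith [sq_nonneg (M - T)]
    · nlinarith [mul_le_mul_of_nonneg_right h (hM.trans hMT), sq_nonneg y]
  · nlinarith

theorem df_pointwise_qp_le_three (p q : ℝ) (hq : 1 < q) (hqp : q < p) (hp : p ≤ 3)
    (N : ℕ) (hN : 1 ≤ N) :
    ∃ C > 0, ∀ s : Fin N → ℝ,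
      |fD' p q (∑ n, s n) - ∑ n, fD' p q (s n)| ≤
        C * ((∑ n, ∑ n', if n = n' then 0 else
                |s n| ^ ((q - 1) / 2) * |s n'| ^ ((q - 1) / 2)) +
             (∑ n, ∑ n', if n = n' then 0 else
                |s n| ^ ((p - 1) / 2) * |s n'| ^ ((p - 1) / 2))) := by
  refine ⟨3 * p, by linarith, fun s => ?_⟩
  have hP := abs_abs_sum_rpow_sub_sum_le (α := p - 1) (by linarith) (by linarith) hN s
  have hQ := abs_abs_sum_rpow_sub_sum_le (α := q - 1) (by linarith) (by linarith) hN s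
  simp only [fD', Finset.sum_sub_distrib, ← Finset.mul_sum]
  have hsplit : ∀ a a' b b' : ℝ, p * a - q * b - (p * a' - q * b') =
      p * (a - a') - q * (b - b') := fun _ _ _ _ => by ring
  rw [hsplit]
  refine (abs_sub _ _).trans ?_
  rw [abs_mul, abs_mul, abs_of_pos (by linarith : 0 < p), abs_of_pos (by linarith : 0 < q)]
  have h1 := mul_le_mul_of_nonneg_left hP (by linarith : 0 ≤ p)
  have h2 := mul_le_mul hqp.le hQ (abs_nonneg _) (by linarith : 0 ≤ p)
  linarith
end

section
/- Let p, q be real numbers with 3 < q < p < ∞ and let N ≥ 1 be an integer. Then there exists a constant C > 0 (depending only on p, q, N) such that for all (s_1, …, s_N) ∈ ℝ^N one has |f'(∑_{n=1}^N s_n) − ∑_{n=1}^N f'(s_n)| ≤ C ( ∑_{n ≠ n'} |s_n|^{q−2} |s_{n'}| + ∑_{n ≠ n'} |s_n|^{p−2} |s_{n'}| ), where the sums ∑_{n ≠ n'} run over ordered pairs (n, n') with 1 ≤ n, n' ≤ N and n ≠ n'. -/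
theorem abs_rpow_sub_rpow_le {a M x y : ℝ} (ha : 1 ≤ a) (hx : x ∈ Set.Icc 0 M)
    (hy : y ∈ Set.Icc 0 M) : |x ^ a - y ^ a| ≤ a * M ^ (a - 1) * |x - y| := by
  refine (convex_Icc 0 M).norm_image_sub_le_of_norm_hasDerivWithin_le
    (f := fun t : ℝ => t ^ a) (f' := fun t => a * t ^ (a - 1))
    (fun t _ => (Real.hasDerivAt_rpow_const (Or.inr ha)).hasDerivWithinAt) (fun t ht => ?_) hy hx
  have h : 0 ≤ t ^ (a - 1) := Real.rpow_nonneg ht.1 _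
  rw [Real.norm_of_nonneg (by positivity)]
  exact mul_le_mul_of_nonneg_left (Real.rpow_le_rpow ht.1 ht.2 (by linarith)) (by linarith)

theorem abs_rpow_abs_sum_sub_sum_le {ι : Type*} [Fintype ι] [DecidableEq ι] [Nonempty ι]
    {a : ℝ} (ha : 1 ≤ a) (s : ι → ℝ) :
    |(|∑ n, s n| ^ a) - ∑ n, |s n| ^ a| ≤
      (a * (Fintype.card ι : ℝ) ^ (a - 1) + 1) *
        ∑ n, ∑ n', if n = n' then 0 else |s n| ^ (a - 1) * |s n'| := by
  obtain ⟨m, hm⟩ := Finite.exists_max (fun n => |s n|)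
  set K : ℝ := (Fintype.card ι : ℝ) with hK
  have hK1 : 1 ≤ K := by
    rw [hK]; exact_mod_cast Fintype.card_pos
  set T : ℝ := ∑ n ∈ Finset.univ.erase m, |s n|
  have hS : |∑ n, s n| ≤ K * |s m| := by
    refine (Finset.abs_sum_le_sum_abs _ _).trans ?_
    simpa [hK] using Finset.sum_le_card_nsmul Finset.univ _ _ (fun n _ => hm n)
  have hdiff : |(|∑ n, s n|) - (|s m|)| ≤ T := by
    refine (abs_abs_sub_abs_le_abs_sub _ _).trans ?_
    rw [← Finset.add_sum_erase _ _ (Finset.mem_univ m), add_sub_cancel_left]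
    exact Finset.abs_sum_le_sum_abs _ _
  have hmain : |(|∑ n, s n| ^ a) - (|s m| ^ a)| ≤ a * K ^ (a - 1) * (|s m| ^ (a - 1) * T) := by
    have h := abs_rpow_sub_rpow_le ha (M := K * |s m|) ⟨abs_nonneg _, hS⟩
      ⟨abs_nonneg (s m), le_mul_of_one_le_left (abs_nonneg _) hK1⟩
    rw [Real.mul_rpow (by linarith) (abs_nonneg _)] at h
    calc _ ≤ _ := h
      _ ≤ a * (K ^ (a - 1) * |s m| ^ (a - 1)) * T := by gcongr
      _ = _ := by ring
  have hrest : ∑ n ∈ Finset.univ.erase m, |s n| ^ a ≤ |s m| ^ (a - 1) * T := by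
    rw [Finset.mul_sum]
    refine Finset.sum_le_sum fun n _ => ?_
    calc |s n| ^ a = |s n| ^ (a - 1) * |s n| := by
          conv_lhs => rw [← sub_add_cancel a 1]
          rw [Real.rpow_add_one' (abs_nonneg _) (by linarith)]
      _ ≤ |s m| ^ (a - 1) * |s n| :=
          mul_le_mul_of_nonneg_right
            (Real.rpow_le_rpow (abs_nonneg _) (hm n) (by linarith)) (abs_nonneg _)
  have hrow : |s m| ^ (a - 1) * T ≤
      ∑ n, ∑ n', if n = n' then 0 else |s n| ^ (a - 1) * |s n'| := by
    have hnn : ∀ n n', 0 ≤ if n = n' then 0 else |s n| ^ (a - 1) * |s n'| := by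
      intro n n'; split_ifs <;> positivity
    refine le_trans (le_of_eq ?_) (Finset.single_le_sum
      (fun n _ => Finset.sum_nonneg fun n' _ => hnn n n') (Finset.mem_univ m))
    rw [← Finset.add_sum_erase _ _ (Finset.mem_univ m), if_pos rfl, zero_add, Finset.mul_sum]
    exact Finset.sum_congr rfl fun n hn => by rw [if_neg (Finset.ne_of_mem_erase hn).symm]
  have hrest0 : 0 ≤ ∑ n ∈ Finset.univ.erase m, |s n| ^ a :=
    Finset.sum_nonneg fun n _ => by positivity
  rw [← Finset.add_sum_erase _ (fun n => |s n| ^ a) (Finset.mem_univ m), ← sub_sub]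
  calc _ ≤ |(|∑ n, s n| ^ a) - (|s m| ^ a)| + |∑ n ∈ Finset.univ.erase m, (|s n| ^ a)| := abs_sub _ _
    _ ≤ a * K ^ (a - 1) * (|s m| ^ (a - 1) * T) + |s m| ^ (a - 1) * T := by
        rw [abs_of_nonneg hrest0]; exact add_le_add hmain hrest
    _ = (a * K ^ (a - 1) + 1) * (|s m| ^ (a - 1) * T) := by ring
    _ ≤ _ := mul_le_mul_of_nonneg_left hrow (by positivity)

theorem df_pointwise_three_lt_qp (p q : ℝ) (hq : 3 < q) (hqp : q < p)
    (N : ℕ) (hN : 1 ≤ N) :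
    ∃ C > 0, ∀ s : Fin N → ℝ,
      |fD' p q (∑ n, s n) - ∑ n, fD' p q (s n)| ≤
        C * ((∑ n, ∑ n', if n = n' then 0 else
                |s n| ^ (q - 2) * |s n'|) +
             (∑ n, ∑ n', if n = n' then 0 else
                |s n| ^ (p - 2) * |s n'|)) := by
  have : Nonempty (Fin N) := ⟨⟨0, hN⟩⟩
  have hp1 : 0 < p - 1 := by linarith
  have hq1 : 0 < q - 1 := by linarith
  have hp0 : 0 < p := by linarith
  have hq0 : 0 < q := by linarith
  set A : ℝ := (p - 1) * (N : ℝ) ^ (p - 2) + 1 with hA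
  set B : ℝ := (q - 1) * (N : ℝ) ^ (q - 2) + 1 with hB
  have hA0 : 0 < A := by positivity
  have hB0 : 0 < B := by positivity
  refine ⟨p * A + q * B, by positivity, fun s => ?_⟩
  have h1 := abs_rpow_abs_sum_sub_sum_le (a := p - 1) (by linarith) s
  have h2 := abs_rpow_abs_sum_sub_sum_le (a := q - 1) (by linarith) s
  rw [Fintype.card_fin, show p - 1 - 1 = p - 2 by ring, ← hA] at h1
  rw [Fintype.card_fin, show q - 1 - 1 = q - 2 by ring, ← hB] at h2
  have hnn : ∀ r : ℝ, 0 ≤ ∑ n, ∑ n', if n = n' then 0 else |s n| ^ r * |s n'| := fun r =>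
    Finset.sum_nonneg fun n _ => Finset.sum_nonneg fun n' _ => by split_ifs <;> positivity
  have hP := hnn (p - 2)
  have hQ := hnn (q - 2)
  set P := ∑ n, ∑ n', if n = n' then 0 else |s n| ^ (p - 2) * |s n'|
  set Q := ∑ n, ∑ n', if n = n' then 0 else |s n| ^ (q - 2) * |s n'|
  have hsplit : fD' p q (∑ n, s n) - ∑ n, fD' p q (s n) =
      p * (|∑ n, s n| ^ (p - 1) - ∑ n, |s n| ^ (p - 1)) -
        q * (|∑ n, s n| ^ (q - 1) - ∑ n, |s n| ^ (q - 1)) := by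
    simp only [fD', Finset.sum_sub_distrib, ← Finset.mul_sum]
    ring
  rw [hsplit]
  calc _ ≤ _ := abs_sub _ _
    _ ≤ p * (A * P) + q * (B * Q) := by
        rw [abs_mul, abs_mul, abs_of_pos hp0, abs_of_pos hq0]
        gcongr
    _ ≤ _ := by
        have : 0 ≤ p * A * Q := by positivity
        have : 0 ≤ q * B * P := by positivity
        linarith
end

section
/- Let p, q be real numbers with 1 < q < p < ∞ and let N ≥ 1 be an integer. Then there exists a constant C > 0 (depending only on p, q, N) such that for all (s_1, …, s_N) ∈ ℝ^N one has |f(∑_{n=1}^N s_n) − ∑_{n=1}^N f(s_n)| ≤ C ( ∑_{n ≠ n'} |s_n|^{q−1} |s_{n'}| + ∑_{n ≠ n'} |s_n|^{p−1} |s_{n'}| ), where the sums ∑_{n ≠ n'} run over ordered pairs (n, n') with 1 ≤ n, n' ≤ N and n ≠ n'. -/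
/-- The double power nonlinearity `f(s) = |s|^(p-1) s - |s|^(q-1) s` (real exponents). -/
noncomputable def fD (p q s : ℝ) : ℝ := |s| ^ (p - 1) * s - |s| ^ (q - 1) * s

open Finset in
/-- A quantitative power-of-sum bound, valid for all nonnegative exponents. -/
theorem sum_rpow_le_card_rpow_mul_sum_rpow {ι : Type*} {t : Finset ι} (ht : t.Nonempty)
    {x : ι → ℝ} (hx : ∀ i, 0 ≤ x i) {a : ℝ} (ha : 0 ≤ a) :
    (∑ i ∈ t, x i) ^ a ≤ (#t : ℝ) ^ a * ∑ i ∈ t, x i ^ a := by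
  obtain ⟨m, hm, hmax⟩ := t.exists_max_image x ht
  have hsum : ∑ i ∈ t, x i ≤ #t * x m := by
    simpa [nsmul_eq_mul] using t.sum_le_card_nsmul x (x m) hmax
  calc (∑ i ∈ t, x i) ^ a ≤ (#t * x m) ^ a :=
        Real.rpow_le_rpow (sum_nonneg fun i _ => hx i) hsum ha
    _ = (#t : ℝ) ^ a * x m ^ a := Real.mul_rpow (by positivity) (hx m)
    _ ≤ _ := by
        gcongr
        exact single_le_sum (f := fun i => x i ^ a) (fun i _ => Real.rpow_nonneg (hx i) a) hm

theorem abs_rpow_sub_rpow_le_of_one_le {a M u v : ℝ} (ha : 1 ≤ a) (hu : 0 ≤ u) (hv : 0 ≤ v)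
    (huM : u ≤ M) (hvM : v ≤ M) : |u ^ a - v ^ a| ≤ a * M ^ (a - 1) * |u - v| := by
  refine (convex_Icc (0 : ℝ) M).norm_image_sub_le_of_norm_hasDerivWithin_le
    (f := fun y : ℝ => y ^ a) (f' := fun y => a * y ^ (a - 1))
    (fun y _ => (Real.hasDerivAt_rpow_const (Or.inr ha)).hasDerivWithinAt)
    (fun y hy => ?_) ⟨hv, hvM⟩ ⟨hu, huM⟩
  have hy0 := hy.1
  rw [Real.norm_of_nonneg (by positivity)]
  exact mul_le_mul_of_nonneg_left (Real.rpow_le_rpow hy0 hy.2 (by linarith)) (by linarith)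

theorem abs_rpow_sub_rpow_le_of_le_one {a u v : ℝ} (ha : 0 ≤ a) (ha1 : a ≤ 1) (hu : 0 ≤ u)
    (hv : 0 ≤ v) : |u ^ a - v ^ a| ≤ |u - v| ^ a := by
  wlog h : v ≤ u generalizing u v
  · rw [abs_sub_comm, abs_sub_comm u]
    exact this hv hu (le_of_not_ge h)
  rw [abs_of_nonneg (sub_nonneg.2 (Real.rpow_le_rpow hv h ha)), abs_of_nonneg (sub_nonneg.2 h)]
  have := Real.rpow_add_le_add_rpow (sub_nonneg.2 h) hv ha ha1
  rw [sub_add_cancel] at this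
  linarith

theorem abs_mul_rpow_self {a : ℝ} (ha : 0 < a) (x : ℝ) : |x| * |x| ^ (a - 1) = |x| ^ a := by
  rcases (abs_nonneg x).eq_or_lt with h | h
  · rw [← h, zero_mul, Real.zero_rpow ha.ne']
  · rw [Real.rpow_sub_one h.ne']
    field_simp

theorem exists_abs_mul_abs_rpow_add_sub_le {a : ℝ} (ha : 0 < a) :
    ∃ C > 0, ∀ x t : ℝ,
      |x| * |(|x + t| ^ a - |x| ^ a)| ≤ C * (|x| ^ a * |t| + |x| * |t| ^ a) := by
  have htri (x t : ℝ) : |(|x + t| - |x|)| ≤ |t| := by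
    simpa using abs_abs_sub_abs_le_abs_sub (x + t) x
  rcases le_total a 1 with h1 | h1
  · refine ⟨1, one_pos, fun x t => ?_⟩
    have h := (abs_rpow_sub_rpow_le_of_le_one ha.le h1 (abs_nonneg (x + t)) (abs_nonneg x)).trans
      (Real.rpow_le_rpow (abs_nonneg _) (htri x t) ha.le)
    have := mul_le_mul_of_nonneg_left h (abs_nonneg x)
    have : 0 ≤ |x| ^ a * |t| := by positivity
    linarith
  · refine ⟨a * 2 ^ (a - 1), by positivity, fun x t => ?_⟩
    have h := abs_rpow_sub_rpow_le_of_one_le (M := |x| + |t|) h1 (abs_nonneg (x + t))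
      (abs_nonneg x) (abs_add_le x t) (by linarith [abs_nonneg t])
    have hsum : (|x| + |t|) ^ (a - 1) ≤ 2 ^ (a - 1) * (|x| ^ (a - 1) + |t| ^ (a - 1)) := by
      simpa using sum_rpow_le_card_rpow_mul_sum_rpow (t := (Finset.univ : Finset (Fin 2)))
        Finset.univ_nonempty (x := ![|x|, |t|]) (fun i => by fin_cases i <;> simp)
        (sub_nonneg.2 h1)
    calc |x| * |(|x + t| ^ a - |x| ^ a)|
        ≤ |x| * (a * (2 ^ (a - 1) * (|x| ^ (a - 1) + |t| ^ (a - 1))) * |t|) := by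
          refine mul_le_mul_of_nonneg_left (h.trans ?_) (abs_nonneg x)
          exact mul_le_mul (mul_le_mul_of_nonneg_left hsum (by positivity)) (htri x t)
            (abs_nonneg _) (by positivity)
      _ = a * 2 ^ (a - 1) * ((|x| * |x| ^ (a - 1)) * |t| + |x| * (|t| * |t| ^ (a - 1))) := by
          ring
      _ = _ := by rw [abs_mul_rpow_self ha, abs_mul_rpow_self ha]

open Finset in
theorem exists_abs_rpow_mul_sum_sub_le {ι : Type*} [Fintype ι] [DecidableEq ι] {a : ℝ}
    (ha : 0 < a) :
    ∃ C > 0, ∀ s : ι → ℝ,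
      |(|∑ n, s n| ^ a * ∑ n, s n - ∑ n, |s n| ^ a * s n)| ≤
        C * ∑ n, ∑ n', if n = n' then 0 else |s n| ^ a * |s n'| := by
  obtain ⟨C, hC, hbound⟩ := exists_abs_mul_abs_rpow_add_sub_le ha
  set K : ℝ := (Fintype.card ι : ℝ) ^ a
  have hK : 0 ≤ K := by positivity
  refine ⟨C * (1 + K), by positivity, fun s => ?_⟩
  have hterm (n : ι) : |s n| * |(|∑ m, s m| ^ a - |s n| ^ a)| ≤
      C * ((∑ n', if n = n' then 0 else |s n| ^ a * |s n'|) +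
        K * ∑ n', if n = n' then 0 else |s n'| ^ a * |s n|) := by
    have hS : ∑ m, s m = s n + ∑ m ∈ univ.erase n, s m :=
      (add_sum_erase univ s (mem_univ n)).symm
    have hoff (g : ι → ℝ) : (∑ n', if n = n' then 0 else g n') = ∑ n' ∈ univ.erase n, g n' := by
      rw [← add_sum_erase univ _ (mem_univ n), if_pos rfl, zero_add]
      exact sum_congr rfl fun m hm => if_neg (ne_of_mem_erase hm).symm
    have ht : |∑ m ∈ univ.erase n, s m| ≤ ∑ m ∈ univ.erase n, |s m| := abs_sum_le_sum_abs _ _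
    have hta : |∑ m ∈ univ.erase n, s m| ^ a ≤ K * ∑ m ∈ univ.erase n, |s m| ^ a := by
      rcases (univ.erase n).eq_empty_or_nonempty with h0 | h0
      · simp [h0, Real.zero_rpow ha.ne']
      · refine (Real.rpow_le_rpow (abs_nonneg _) ht ha.le).trans
          ((sum_rpow_le_card_rpow_mul_sum_rpow h0 (fun i => abs_nonneg (s i)) ha.le).trans ?_)
        have hcard : (#(univ.erase n) : ℝ) ≤ Fintype.card ι := mod_cast card_le_univ _
        exact mul_le_mul_of_nonneg_right (Real.rpow_le_rpow (by positivity) hcard ha.le)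
          (sum_nonneg fun i _ => by positivity)
    rw [hoff, hoff, hS, ← mul_sum, ← sum_mul]
    refine (hbound _ _).trans (mul_le_mul_of_nonneg_left ?_ hC.le)
    have h1 := mul_le_mul_of_nonneg_left ht (Real.rpow_nonneg (abs_nonneg (s n)) a)
    have h2 := mul_le_mul_of_nonneg_left hta (abs_nonneg (s n))
    linarith
  calc |(|∑ n, s n| ^ a * ∑ n, s n - ∑ n, |s n| ^ a * s n)|
      = |∑ n, s n * (|∑ m, s m| ^ a - |s n| ^ a)| := by
        rw [mul_sum, ← sum_sub_distrib]
        exact congrArg _ (sum_congr rfl fun n _ => by ring)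
    _ ≤ ∑ n, |s n| * |(|∑ m, s m| ^ a - |s n| ^ a)| := by
        simpa only [abs_mul] using
          abs_sum_le_sum_abs (fun n => s n * (|∑ m, s m| ^ a - |s n| ^ a)) univ
    _ ≤ _ := sum_le_sum fun n _ => hterm n
    _ = _ := by
        rw [← mul_sum, sum_add_distrib, ← mul_sum,
          sum_comm (f := fun n n' => if n = n' then 0 else |s n'| ^ a * |s n|)]
        simp only [eq_comm (a := (_ : ι))]
        ring

theorem f_pointwise (p q : ℝ) (hq : 1 < q) (hqp : q < p)
    (N : ℕ) (hN : 1 ≤ N) :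
    ∃ C > 0, ∀ s : Fin N → ℝ,
      |fD p q (∑ n, s n) - ∑ n, fD p q (s n)| ≤
        C * ((∑ n, ∑ n', if n = n' then 0 else
                |s n| ^ (q - 1) * |s n'|) +
             (∑ n, ∑ n', if n = n' then 0 else
                |s n| ^ (p - 1) * |s n'|)) := by
  obtain ⟨A, hA, hp⟩ := exists_abs_rpow_mul_sum_sub_le (ι := Fin N) (a := p - 1) (by linarith)
  obtain ⟨B, hB, hq⟩ := exists_abs_rpow_mul_sum_sub_le (ι := Fin N) (a := q - 1) (by linarith)
  refine ⟨A + B, by positivity, fun s => ?_⟩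
  have hnonneg (a : ℝ) : 0 ≤ ∑ n, ∑ n', if n = n' then 0 else |s n| ^ a * |s n'| :=
    Finset.sum_nonneg fun n _ => Finset.sum_nonneg fun n' _ => by split_ifs <;> positivity
  have hsplit : fD p q (∑ n, s n) - ∑ n, fD p q (s n) =
      (|∑ n, s n| ^ (p - 1) * ∑ n, s n - ∑ n, |s n| ^ (p - 1) * s n) -
        (|∑ n, s n| ^ (q - 1) * ∑ n, s n - ∑ n, |s n| ^ (q - 1) * s n) := by
    simp only [fD, Finset.sum_sub_distrib]
    ring
  rw [hsplit]
  refine (abs_sub _ _).trans ((add_le_add (hp s) (hq s)).trans ?_)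
  have h1 := mul_nonneg hA.le (hnonneg (q - 1))
  have h2 := mul_nonneg hB.le (hnonneg (p - 1))
  linarith
end

section
/- Let p, q be real numbers with 1 < q < p < ∞ and let N ≥ 1 be an integer. Then there exists a constant C > 0 (depending only on p, q, N) such that for all (s_1, …, s_N) ∈ ℝ^N one has |F(∑_{n=1}^N s_n) − ∑_{n=1}^N F(s_n)| ≤ C ( ∑_{n ≠ n'} |s_n|^{q} |s_{n'}| + ∑_{n ≠ n'} |s_n|^{p} |s_{n'}| ), where the sums ∑_{n ≠ n'} run over ordered pairs (n, n') with 1 ≤ n, n' ≤ N and n ≠ n'. -/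
/-- The antiderivative, vanishing at `0`, of the double power nonlinearity
`f(s) = |s|^(p-1) s - |s|^(q-1) s`:  `F(s) = |s|^(p+1)/(p+1) - |s|^(q+1)/(q+1)`. -/
noncomputable def FD (p q s : ℝ) : ℝ := |s| ^ (p + 1) / (p + 1) - |s| ^ (q + 1) / (q + 1)

/-- The power difference is controlled by the mean value bound at the larger point. -/
theorem rpow_add_one_sub_le {r x y : ℝ} (hr : 0 ≤ r) (hx : 0 ≤ x) (hxy : x ≤ y) :
    y ^ (r + 1) - x ^ (r + 1) ≤ (r + 1) * y ^ r * (y - x) := by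
  rcases hx.eq_or_lt with rfl | hx0
  · rw [Real.zero_rpow (by linarith), Real.rpow_add_one' hxy (by linarith)]
    have : 0 ≤ r * (y ^ r * y) := by positivity
    linarith
  have hy : 0 < y := hx0.trans_le hxy
  have hB := one_add_mul_self_le_rpow_one_add (s := x / y - 1) (p := r + 1)
    (by have : 0 ≤ x / y := by positivity
        linarith) (by linarith)
  rw [add_sub_cancel, Real.div_rpow hx hy.le, le_div_iff₀ (by positivity),
    Real.rpow_add_one hy.ne' r] at hB
  rw [Real.rpow_add_one hy.ne' r]
  have e : (1 + (r + 1) * (x / y - 1)) * (y ^ r * y)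
      = y ^ r * y - (r + 1) * y ^ r * (y - x) := by
    field_simp
    ring
  linarith

theorem abs_rpow_add_one_sub_le {r x y M : ℝ} (hr : 0 ≤ r) (hx : 0 ≤ x) (hy : 0 ≤ y)
    (hxM : x ≤ M) (hyM : y ≤ M) :
    |y ^ (r + 1) - x ^ (r + 1)| ≤ (r + 1) * M ^ r * |y - x| := by
  wlog hxy : x ≤ y generalizing x y
  · rw [abs_sub_comm, abs_sub_comm y x]
    exact this hy hx hyM hxM (le_of_not_ge hxy)
  have hm : x ^ (r + 1) ≤ y ^ (r + 1) := Real.rpow_le_rpow hx hxy (by linarith)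
  rw [abs_of_nonneg (sub_nonneg.2 hm), abs_of_nonneg (sub_nonneg.2 hxy)]
  refine (rpow_add_one_sub_le hr hx hxy).trans ?_
  have : 0 ≤ y - x := sub_nonneg.2 hxy
  gcongr

/-- The pure power `|s| ^ (r + 1)` is additive up to the mixed terms `|s n| ^ r * |s n'|`. -/
theorem abs_rpow_sum_sub_sum_le {r : ℝ} (hr : 0 ≤ r) {N : ℕ} (hN : 1 ≤ N) (s : Fin N → ℝ) :
    |(|∑ n, s n| ^ (r + 1) - ∑ n, |s n| ^ (r + 1))| ≤
      ((r + 1) * (N : ℝ) ^ r + 1) *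
        ∑ n, ∑ n', if n = n' then 0 else |s n| ^ r * |s n'| := by
  have : Nonempty (Fin N) := ⟨⟨0, hN⟩⟩
  obtain ⟨m, hm⟩ := Finite.exists_max (fun n => |s n|)
  set a := |s m| with ha
  have ha0 : 0 ≤ a := abs_nonneg _
  set T := ∑ n ∈ Finset.univ.erase m, |s n| with hT
  have hsplit (f : Fin N → ℝ) : ∑ n, f n = f m + ∑ n ∈ Finset.univ.erase m, f n :=
    (Finset.add_sum_erase _ f (Finset.mem_univ m)).symm
  have hb : |(∑ n, s n) - s m| ≤ T := by
    rw [hsplit s, add_sub_cancel_left]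
    exact Finset.abs_sum_le_sum_abs _ _
  have hsum : |∑ n, s n| ≤ N * a := by
    refine (Finset.abs_sum_le_sum_abs _ _).trans ?_
    simpa using Finset.sum_le_card_nsmul Finset.univ (fun n => |s n|) a (fun n _ => hm n)
  have hN1 : (1 : ℝ) ≤ N := by exact_mod_cast hN
  have haN : a ≤ N * a := le_mul_of_one_le_left ha0 hN1
  have h1 : |(|∑ n, s n| ^ (r + 1) - a ^ (r + 1))| ≤ (r + 1) * (N : ℝ) ^ r * (a ^ r * T) := by
    refine (abs_rpow_add_one_sub_le hr ha0 (abs_nonneg _) haN hsum).trans ?_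
    rw [Real.mul_rpow (by positivity) ha0]
    calc (r + 1) * ((N : ℝ) ^ r * a ^ r) * |(|∑ n, s n| - a)|
        ≤ (r + 1) * ((N : ℝ) ^ r * a ^ r) * T := by
          gcongr
          exact (abs_abs_sub_abs_le_abs_sub _ _).trans hb
      _ = _ := by ring
  have h2 : ∑ n ∈ Finset.univ.erase m, |s n| ^ (r + 1) ≤ a ^ r * T := by
    rw [hT, Finset.mul_sum]
    refine Finset.sum_le_sum fun n _ => ?_
    rw [Real.rpow_add_one' (abs_nonneg _) (by linarith)]
    gcongr
    exact hm n
  have h20 : 0 ≤ ∑ n ∈ Finset.univ.erase m, |s n| ^ (r + 1) :=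
    Finset.sum_nonneg fun n _ => by positivity
  have h3 : a ^ r * T ≤ ∑ n, ∑ n', if n = n' then 0 else |s n| ^ r * |s n'| := by
    have hrow : a ^ r * T = ∑ n', if m = n' then 0 else |s m| ^ r * |s n'| := by
      rw [hsplit, if_pos rfl, zero_add, hT, Finset.mul_sum]
      refine Finset.sum_congr rfl fun n hn => ?_
      rw [if_neg (Finset.ne_of_mem_erase hn).symm]
    rw [hrow]
    refine Finset.single_le_sum (f := fun n => ∑ n', if n = n' then 0 else |s n| ^ r * |s n'|)
      (fun n _ => Finset.sum_nonneg fun n' _ => ?_) (Finset.mem_univ m)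
    split_ifs <;> positivity
  have hC : 0 ≤ (r + 1) * (N : ℝ) ^ r + 1 := by positivity
  refine le_trans ?_ (mul_le_mul_of_nonneg_left h3 hC)
  rw [hsplit (fun n => |s n| ^ (r + 1))]
  rw [abs_le] at h1 ⊢
  constructor <;> linarith [h1.1, h1.2]

theorem F_pointwise (p q : ℝ) (hq : 1 < q) (hqp : q < p)
    (N : ℕ) (hN : 1 ≤ N) :
    ∃ C > 0, ∀ s : Fin N → ℝ,
      |FD p q (∑ n, s n) - ∑ n, FD p q (s n)| ≤
        C * ((∑ n, ∑ n', if n = n' then 0 else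
                |s n| ^ q * |s n'|) +
             (∑ n, ∑ n', if n = n' then 0 else
                |s n| ^ p * |s n'|)) := by
  have hq0 : 0 ≤ q := by linarith
  have hp0 : 0 ≤ p := by linarith
  refine ⟨((p + 1) * (N : ℝ) ^ p + 1) + ((q + 1) * (N : ℝ) ^ q + 1), by positivity, fun s => ?_⟩
  have hP := abs_rpow_sum_sub_sum_le hp0 hN s
  have hQ := abs_rpow_sum_sub_sum_le hq0 hN s
  have hnonneg (r : ℝ) : 0 ≤ ∑ n, ∑ n', if n = n' then 0 else |s n| ^ r * |s n'| :=
    Finset.sum_nonneg fun n _ => Finset.sum_nonneg fun n' _ => by split_ifs <;> positivity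
  have hSp := hnonneg p
  have hSq := hnonneg q
  set Sp := ∑ n, ∑ n', if n = n' then 0 else |s n| ^ p * |s n'|
  set Sq := ∑ n, ∑ n', if n = n' then 0 else |s n| ^ q * |s n'|
  have hdiv {r x : ℝ} (hr : 0 ≤ r) : |x / (r + 1)| ≤ |x| := by
    rw [abs_div]
    exact div_le_self (abs_nonneg _) (by rw [abs_of_nonneg] <;> linarith)
  have e : FD p q (∑ n, s n) - ∑ n, FD p q (s n)
      = (|∑ n, s n| ^ (p + 1) - ∑ n, |s n| ^ (p + 1)) / (p + 1)
        - (|∑ n, s n| ^ (q + 1) - ∑ n, |s n| ^ (q + 1)) / (q + 1) := by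
    simp only [FD, Finset.sum_sub_distrib, ← Finset.sum_div]
    ring
  rw [e]
  refine (abs_sub _ _).trans ((add_le_add ((hdiv hp0).trans hP) ((hdiv hq0).trans hQ)).trans ?_)
  have h1 : 0 ≤ ((p + 1) * (N : ℝ) ^ p + 1) * Sq := by positivity
  have h2 : 0 ≤ ((q + 1) * (N : ℝ) ^ q + 1) * Sp := by positivity
  linarith
end

section
/- Let p, q be real numbers with 1 < q < p < ∞ and let M > 0. Then there exists a constant C > 0 (depending only on p, q, M) such that for all s_1, s_2 ∈ ℝ with |s_1| ≤ M, one has |F(s_1 + s_2) − F(s_1) − f(s_1) s_2 − (1/2) f'(s_1) s_2^2| ≤ C ( |s_2|^3 + |s_2|^{q+1} + |s_2|^{p+1} ). -/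
/-- A mean value bound: a primitive vanishing at `0` of a function dominated by a nondecreasing
function of `|x|`. -/
lemma abs_le_mul_abs_of_hasDerivAt {u u' B : ℝ → ℝ} (h0 : u 0 = 0)
    (hu : ∀ x, HasDerivAt u (u' x) x) (hB : ∀ x y, |x| ≤ |y| → B x ≤ B y)
    (hu' : ∀ x, |u' x| ≤ B x) (h : ℝ) : |u h| ≤ B h * |h| := by
  have key := (convex_closedBall (0 : ℝ) |h|).norm_image_sub_le_of_norm_hasDerivWithin_le
    (f := u) (f' := u') (C := B h) (x := 0) (y := h)
    (fun x _ => (hu x).hasDerivWithinAt)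
    (fun x hx => (hu' x).trans (hB x h (by simpa using hx)))
    (by simp) (by simp)
  simpa [h0] using key

lemma hasDerivAt_abs_rpow_mul_self {a : ℝ} (ha : 0 < a) (x : ℝ) :
    HasDerivAt (fun y : ℝ => |y| ^ a * y) ((a + 1) * |x| ^ a) x := by
  have hc : Continuous fun y : ℝ => |y| ^ a := continuous_abs.rpow_const fun _ => Or.inr ha.le
  refine hasDerivAt_of_hasDerivAt_of_ne' (f := fun y : ℝ => |y| ^ a * y)
    (g := fun y => (a + 1) * |y| ^ a) (x := 0) (fun y hy => ?_)
    (hc.mul continuous_id).continuousAt (hc.const_mul _).continuousAt x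
  have hy' : |y| ≠ 0 := abs_ne_zero.2 hy
  refine (((hasDerivAt_abs hy).rpow_const (p := a) (Or.inl hy')).mul
    (hasDerivAt_id y)).congr_deriv ?_
  have h1 : (SignType.sign y : ℝ) * y = |y| := sign_mul_self y
  have h2 : |y| ^ (a - 1) * |y| = |y| ^ a := by
    rw [← Real.rpow_add_one hy', sub_add_cancel]
  simp only [id]
  linear_combination a * |y| ^ (a - 1) * h1 + a * h2

lemma abs_rpow_sub_rpow_le_of_le_one_s6 {a x y : ℝ} (ha : 0 < a) (ha1 : a ≤ 1) (hx : 0 ≤ x)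
    (hy : 0 ≤ y) : |x ^ a - y ^ a| ≤ |x - y| ^ a := by
  wlog hxy : y ≤ x generalizing x y
  · rw [abs_sub_comm, abs_sub_comm x y]
    exact this hy hx (le_of_not_ge hxy)
  have h1 := Real.rpow_add_le_add_rpow hy (sub_nonneg.2 hxy) ha.le ha1
  rw [add_sub_cancel] at h1
  rw [abs_of_nonneg (sub_nonneg.2 (Real.rpow_le_rpow hy hxy ha.le)),
    abs_of_nonneg (sub_nonneg.2 hxy)]
  linarith

lemma abs_rpow_sub_rpow_le_of_one_le_s6 {a x y L : ℝ} (ha : 1 ≤ a) (hx : x ∈ Set.Icc 0 L)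
    (hy : y ∈ Set.Icc 0 L) : |x ^ a - y ^ a| ≤ a * L ^ (a - 1) * |x - y| := by
  refine (convex_Icc 0 L).norm_image_sub_le_of_norm_hasDerivWithin_le
    (f := fun t : ℝ => t ^ a) (f' := fun t => a * t ^ (a - 1))
    (fun t _ => (Real.hasDerivAt_rpow_const (Or.inr ha)).hasDerivWithinAt)
    (fun t ht => ?_) hy hx
  rw [Real.norm_of_nonneg (mul_nonneg (by linarith) (Real.rpow_nonneg ht.1 _))]
  gcongr
  exacts [ht.1, ht.2]

lemma add_rpow_le_two_mul_rpow_add {a x y : ℝ} (ha : 0 ≤ a) (hx : 0 ≤ x) (hy : 0 ≤ y) :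
    (x + y) ^ a ≤ (2 * x) ^ a + (2 * y) ^ a := by
  rcases le_total x y with h | h
  · have := Real.rpow_le_rpow (by positivity) (show x + y ≤ 2 * y by linarith) ha
    have : 0 ≤ (2 * x) ^ a := by positivity
    linarith
  · have := Real.rpow_le_rpow (by positivity) (show x + y ≤ 2 * x by linarith) ha
    have : 0 ≤ (2 * y) ^ a := by positivity
    linarith

lemma exists_abs_rpow_add_sub_le (a M : ℝ) (ha : 0 < a) (hM : 0 < M) :
    ∃ C > 0, ∀ s h : ℝ, |s| ≤ M → |(|s + h| ^ a - |s| ^ a)| ≤ C * (|h| + |h| ^ a) := by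
  have hd (s h : ℝ) : |(|s + h| - |s|)| ≤ |h| := by
    simpa using abs_abs_sub_abs_le_abs_sub (s + h) s
  rcases le_total a 1 with ha1 | ha1
  · refine ⟨1, one_pos, fun s h _ => ?_⟩
    have h1 := abs_rpow_sub_rpow_le_of_le_one_s6 ha ha1 (abs_nonneg (s + h)) (abs_nonneg s)
    have h2 := Real.rpow_le_rpow (abs_nonneg _) (hd s h) ha.le
    linarith [abs_nonneg h]
  · refine ⟨a * ((2 * M) ^ (a - 1) + 2 ^ (a - 1)), by positivity, fun s h hs => ?_⟩
    have hL : |s + h| ≤ M + |h| := (abs_add_le s h).trans (by gcongr)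
    have h1 := abs_rpow_sub_rpow_le_of_one_le_s6 ha1 ⟨abs_nonneg (s + h), hL⟩
      ⟨abs_nonneg s, hs.trans (le_add_of_nonneg_right (abs_nonneg h))⟩
    have h2 := add_rpow_le_two_mul_rpow_add (sub_nonneg.2 ha1) hM.le (abs_nonneg h)
    rw [Real.mul_rpow (z := a - 1) zero_le_two (abs_nonneg h)] at h2
    have h3 : |h| ^ (a - 1) * |h| = |h| ^ a := by
      rw [← Real.rpow_add_one' (abs_nonneg h) (by linarith), sub_add_cancel]
    calc |(|s + h| ^ a - |s| ^ a)|
        ≤ a * ((2 * M) ^ (a - 1) + 2 ^ (a - 1) * |h| ^ (a - 1)) * |h| :=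
          h1.trans (mul_le_mul (by gcongr) (hd s h) (abs_nonneg _) (by positivity))
      _ = a * ((2 * M) ^ (a - 1) * |h| + 2 ^ (a - 1) * |h| ^ a) := by rw [← h3]; ring
      _ ≤ a * ((2 * M) ^ (a - 1) + 2 ^ (a - 1)) * (|h| + |h| ^ a) := by
          have h4 : 0 ≤ a * ((2 * M) ^ (a - 1) * |h| ^ a) := by positivity
          have h5 : 0 ≤ a * ((2 : ℝ) ^ (a - 1) * |h|) := by positivity
          linarith

/-- Second order Taylor estimate for `|s| ^ (r + 1) / (r + 1)`, uniform for bounded base points. -/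
lemma exists_abs_rpow_taylor_le (r M : ℝ) (hr : 1 < r) (hM : 0 < M) :
    ∃ C > 0, ∀ s h : ℝ, |s| ≤ M →
      |(|s + h| ^ (r + 1) / (r + 1) - |s| ^ (r + 1) / (r + 1) - |s| ^ (r - 1) * s * h
        - (1 / 2) * (r * |s| ^ (r - 1)) * h ^ 2)| ≤ C * (|h| ^ (3 : ℝ) + |h| ^ (r + 1)) := by
  obtain ⟨C, hC, hCb⟩ := exists_abs_rpow_add_sub_le (r - 1) M (by linarith) hM
  refine ⟨r * C, by positivity, fun s h hs => ?_⟩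
  have hadd (x : ℝ) : HasDerivAt (fun y => s + y) 1 x := (hasDerivAt_id x).const_add s
  have hg (x : ℝ) : HasDerivAt
      (fun y => |s + y| ^ (r - 1) * (s + y) - |s| ^ (r - 1) * s - r * |s| ^ (r - 1) * y)
      (r * (|s + x| ^ (r - 1) - |s| ^ (r - 1))) x := by
    refine ((((hasDerivAt_abs_rpow_mul_self (a := r - 1) (by linarith) (s + x)).comp x
      (hadd x)).sub_const (|s| ^ (r - 1) * s)).sub
      ((hasDerivAt_id x).const_mul (r * |s| ^ (r - 1)))).congr_deriv ?_
    ring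
  have hG (x : ℝ) : HasDerivAt
      (fun y => |s + y| ^ (r + 1) / (r + 1) - |s| ^ (r + 1) / (r + 1) - |s| ^ (r - 1) * s * y
        - (1 / 2) * (r * |s| ^ (r - 1)) * y ^ 2)
      (|s + x| ^ (r - 1) * (s + x) - |s| ^ (r - 1) * s - r * |s| ^ (r - 1) * x) x := by
    refine ((((((hasDerivAt_abs_rpow (s + x) (p := r + 1) (by linarith)).comp x
      (hadd x)).div_const (r + 1)).sub_const (|s| ^ (r + 1) / (r + 1))).sub
      ((hasDerivAt_id x).const_mul (|s| ^ (r - 1) * s))).sub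
      ((hasDerivAt_pow 2 x).const_mul ((1 / 2) * (r * |s| ^ (r - 1))))).congr_deriv ?_
    rw [show r + 1 - 2 = r - 1 by ring]
    have : r + 1 ≠ 0 := by linarith
    field_simp
    ring
  have hr1 : 0 ≤ r - 1 := by linarith
  have b1 := abs_le_mul_abs_of_hasDerivAt (B := fun x => r * (C * (|x| + |x| ^ (r - 1))))
    (by simp) hg (fun x y hxy => by gcongr)
    (fun x => by
      rw [abs_mul, abs_of_pos (by linarith : 0 < r)]
      gcongr
      exact hCb s x hs)
  have b2 := abs_le_mul_abs_of_hasDerivAt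
    (B := fun x => r * (C * (|x| + |x| ^ (r - 1))) * |x|)
    (by simp) hG (fun x y hxy => by gcongr) b1 h
  refine b2.trans_eq ?_
  have e : |h| ^ (r + 1) = |h| ^ (r - 1) * |h| * |h| := by
    rw [← Real.rpow_add_one' (abs_nonneg h) (by linarith),
      ← Real.rpow_add_one' (abs_nonneg h) (by linarith)]
    ring_nf
  have e3 : |h| ^ (3 : ℝ) = |h| ^ 3 := by exact_mod_cast Real.rpow_natCast |h| 3
  rw [e, e3]
  ring

theorem F_taylor_second_order (p q M : ℝ) (hq : 1 < q) (hqp : q < p) (hM : 0 < M) :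
    ∃ C > 0, ∀ s₁ s₂ : ℝ, |s₁| ≤ M →
      |FD p q (s₁ + s₂) - FD p q s₁ - fD p q s₁ * s₂ - (1 / 2) * fD' p q s₁ * s₂ ^ 2| ≤
        C * (|s₂| ^ (3 : ℝ) + |s₂| ^ (q + 1) + |s₂| ^ (p + 1)) := by
  obtain ⟨A, hA, hAb⟩ := exists_abs_rpow_taylor_le p M (hq.trans hqp) hM
  obtain ⟨B, hB, hBb⟩ := exists_abs_rpow_taylor_le q M hq hM
  refine ⟨A + B, by positivity, fun s h hs => ?_⟩
  have h1 := abs_le.1 (hAb s h hs)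
  have h2 := abs_le.1 (hBb s h hs)
  have h3 : 0 ≤ A * |h| ^ (q + 1) := by positivity
  have h4 : 0 ≤ B * |h| ^ (p + 1) := by positivity
  simp only [FD, fD, fD']
  rw [abs_le]
  constructor <;> linarith
end

section
/- Let N ≥ 2 and let ℓ_1 < ℓ_2 < ⋯ < ℓ_N be real numbers in (−1, 1). For n = 2, …, N set β_n = (ℓ_{n−1} + ℓ_n)/2. Define c_1 = ℓ_1, c_2 = (ℓ_2 − ℓ_1)/(1 − β_2 ℓ_2), and for n = 3, …, N, c_n = ((ℓ_n − ℓ_{n−1})/(1 − β_n ℓ_n)) · ∏_{n'=2}^{n−1} (1 − β_{n'} ℓ_{n'−1})/(1 − β_{n'} ℓ_{n'}). Define c̃_1 = 1 and c̃_n = 1 + ∑_{n'=2}^{n} c_{n'} β_{n'} for n = 2, …, N. Then for every n = 2, …, N one has ∑_{n'=1}^{n} c_{n'} = c̃_n ℓ_n and c̃_n = ∏_{n'=2}^{n} (1 − β_{n'} ℓ_{n'−1})/(1 − β_{n'} ℓ_{n'}). (Note that 1 − β_{n'} ℓ_{n'} > 0 for all n' since |β_{n'}| < 1 and |ℓ_{n'}|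 < 1, so all quotients are well defined.) -/
open Finset in
/-- Closed forms for the partial sums of `c k` and `c k * β k`, valid for arbitrary `β` with
nonvanishing denominators. -/
theorem sum_and_sum_mul_eq_prod {K : Type*} [Field K] {N : ℕ} {ℓ β c : ℕ → K}
    (hne : ∀ n, 2 ≤ n → n ≤ N → 1 - β n * ℓ n ≠ 0)
    (hc1 : c 1 = ℓ 1)
    (hc : ∀ n, 2 ≤ n → n ≤ N →
      c n = ((ℓ n - ℓ (n - 1)) / (1 - β n * ℓ n)) *
        ∏ k ∈ Icc 2 (n - 1), (1 - β k * ℓ (k - 1)) / (1 - β k * ℓ k))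
    {n : ℕ} (hn : 1 ≤ n) (hnN : n ≤ N) :
    (∑ k ∈ Icc 1 n, c k) =
        (∏ k ∈ Icc 2 n, (1 - β k * ℓ (k - 1)) / (1 - β k * ℓ k)) * ℓ n ∧
      1 + ∑ k ∈ Icc 2 n, c k * β k =
        ∏ k ∈ Icc 2 n, (1 - β k * ℓ (k - 1)) / (1 - β k * ℓ k) := by
  induction n, hn using Nat.le_induction with
  | base => simp [hc1]
  | succ m hm ih =>
    obtain ⟨hsum, hsum_mul⟩ := ih (by lia)
    have hden := hne (m + 1) (by lia) hnN
    have hcm := hc (m + 1) (by lia) hnN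
    rw [sum_Icc_succ_top (by lia), sum_Icc_succ_top (by lia), prod_Icc_succ_top (by lia),
      ← add_assoc, hsum, hsum_mul, hcm, Nat.add_sub_cancel]
    generalize ∏ k ∈ Icc 2 m, (1 - β k * ℓ (k - 1)) / (1 - β k * ℓ k) = P
    generalize hd : 1 - β (m + 1) * ℓ (m + 1) = d at hden ⊢
    constructor <;> field_simp <;> rw [← hd] <;> ring

/-- Algebraic identities for the coefficients `c_n`, `c̃_n` used in the combined
energy functional for `N`-solitons of the nonlinear Klein-Gordon equation.
Here `ℓ 1 < ⋯ < ℓ N` are speeds in `(-1,1)`, `β n = (ℓ (n-1) + ℓ n)/2` for `2 ≤ n ≤ N`,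
`c 1 = ℓ 1`, `c n = ((ℓ n - ℓ (n-1))/(1 - β n * ℓ n)) * ∏_{k=2}^{n-1} (1 - β k * ℓ (k-1))/(1 - β k * ℓ k)`
for `2 ≤ n ≤ N` (for `n = 2` the product is empty, recovering
`c 2 = (ℓ 2 - ℓ 1)/(1 - β 2 * ℓ 2)`), `c̃ 1 = 1` and
`c̃ n = 1 + ∑_{k=2}^{n} c k * β k` for `2 ≤ n ≤ N`. -/
theorem coefficients_identity (N : ℕ) (hN : 2 ≤ N) (ℓ β c ct : ℕ → ℝ)
    (hmem : ∀ n, 1 ≤ n → n ≤ N → ℓ n ∈ Set.Ioo (-1 : ℝ) 1)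
    (hmono : ∀ n, 1 ≤ n → n < N → ℓ n < ℓ (n + 1))
    (hβ : ∀ n, 2 ≤ n → n ≤ N → β n = (ℓ (n - 1) + ℓ n) / 2)
    (hc1 : c 1 = ℓ 1)
    (hc : ∀ n, 2 ≤ n → n ≤ N →
      c n = ((ℓ n - ℓ (n - 1)) / (1 - β n * ℓ n)) *
        ∏ k ∈ Finset.Icc 2 (n - 1), (1 - β k * ℓ (k - 1)) / (1 - β k * ℓ k))
    (hct1 : ct 1 = 1)
    (hct : ∀ n, 2 ≤ n → n ≤ N → ct n = 1 + ∑ k ∈ Finset.Icc 2 n, c k * β k) :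
    ∀ n, 2 ≤ n → n ≤ N →
      (∑ k ∈ Finset.Icc 1 n, c k) = ct n * ℓ n ∧
      ct n = ∏ k ∈ Finset.Icc 2 n, (1 - β k * ℓ (k - 1)) / (1 - β k * ℓ k) := by
  have hne : ∀ n, 2 ≤ n → n ≤ N → 1 - β n * ℓ n ≠ 0 := by
    intro n h2 hn
    obtain ⟨h₁, h₂⟩ := hmem n (by lia) hn
    obtain ⟨h₃, h₄⟩ := hmem (n - 1) (by lia) (by lia)
    rw [hβ n h2 hn]
    nlinarith
  intro n h2 hn
  obtain ⟨hsum, hsum_mul⟩ := sum_and_sum_mul_eq_prod hne hc1 hc (by lia : 1 ≤ n) hn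
  rw [hct n h2 hn, hsum_mul]
  exact ⟨hsum, rfl⟩
end

section
/- Let p, q be real numbers with 1 < q < p < ∞. If s_0 > 0 satisfies F(s_0) = s_0^2 / 2, then s_0^p − s_0^q − s_0 > 0; equivalently, f(s_0) − s_0 > 0. -/
theorem f_at_zero_of_F (p q : ℝ) (hq : 1 < q) (hqp : q < p)
    (s₀ : ℝ) (hs₀ : 0 < s₀) (hF : FD p q s₀ = s₀ ^ 2 / 2) :
    0 < s₀ ^ p - s₀ ^ q - s₀ ∧ 0 < fD p q s₀ - s₀ := by
  have rpow_sub_one_mul_self (r : ℝ) : s₀ ^ (r - 1) * s₀ = s₀ ^ r := by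
    rw [← Real.rpow_add_one hs₀.ne', sub_add_cancel]
  have hf : fD p q s₀ = s₀ ^ p - s₀ ^ q := by
    simp only [fD, abs_of_pos hs₀, rpow_sub_one_mul_self]
  have hb : 0 < s₀ ^ q := Real.rpow_pos_of_pos hs₀ q
  simp only [FD, abs_of_pos hs₀, Real.rpow_add_one hs₀.ne'] at hF
  have hp1 : 0 < p + 1 := by linarith
  have hq1 : 0 < q + 1 := by linarith
  have h : s₀ ^ p / (p + 1) = s₀ ^ q / (q + 1) + s₀ / 2 := by
    apply mul_right_cancel₀ hs₀.ne'
    linear_combination hF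
  have hbq : s₀ ^ q / (p + 1) < s₀ ^ q / (q + 1) := by gcongr
  have hsp : s₀ / (p + 1) < s₀ / 2 := by gcongr; linarith
  have key : (s₀ ^ q + s₀) / (p + 1) < s₀ ^ p / (p + 1) := by
    rw [add_div]
    linarith
  have hlt : s₀ ^ q + s₀ < s₀ ^ p := (div_lt_div_iff_of_pos_right hp1).mp key
  rw [hf]
  constructor <;> linarith
end

section
/- Let p, q be real numbers with 1 < q < p < ∞. Then there exists a smallest s_0 > 0 with F(s_0) = s_0^2 / 2; that is, there exists s_0 > 0 such that F(s_0) = s_0^2 / 2 and F(s) < s^2 / 2 for all s ∈ (0, s_0). -/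
/-- A continuous function that is negative at `a` and nonnegative somewhere to the right of `a`
has a first zero to the right of `a`. -/
theorem exists_first_zero {h : ℝ → ℝ} (hc : Continuous h) {a b : ℝ} (hab : a ≤ b)
    (ha : h a < 0) (hb : 0 ≤ h b) :
    ∃ c > a, h c = 0 ∧ ∀ s ∈ Set.Ioo a c, h s < 0 := by
  set A : Set ℝ := Set.Ici a ∩ {s | 0 ≤ h s} with hA
  have hcl : IsClosed A := isClosed_Ici.inter (isClosed_le continuous_const hc)
  have hbdd : BddBelow A := ⟨a, fun s hs => hs.1⟩
  have hmem : sInf A ∈ A := hcl.csInf_mem ⟨b, hab, hb⟩ hbdd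
  have hlt : ∀ s, a ≤ s → s < sInf A → h s < 0 := by
    intro s has hs
    by_contra! hn
    exact absurd (csInf_le hbdd ⟨has, hn⟩) (not_le.mpr hs)
  obtain ⟨c, hcI, hc0⟩ := intermediate_value_Icc hmem.1 hc.continuousOn ⟨ha.le, hmem.2⟩
  have hcs : c = sInf A := le_antisymm hcI.2 (csInf_le hbdd ⟨hcI.1, hc0.ge⟩)
  have hca : a ≠ c := by
    rintro rfl
    exact ha.ne hc0
  exact ⟨c, lt_of_le_of_ne hcI.1 hca, hc0, fun s hs => hlt s hs.1.le (hcs ▸ hs.2)⟩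

theorem FD_eq_sq_mul (p q : ℝ) {s : ℝ} (hs : 0 < s) :
    FD p q s = s ^ 2 * (|s| ^ (p - 1) / (p + 1) - |s| ^ (q - 1) / (q + 1)) := by
  have key : ∀ r : ℝ, s ^ (r + 1) = s ^ 2 * s ^ (r - 1) := by
    intro r
    rw [← Real.rpow_natCast s 2, ← Real.rpow_add hs]
    congr 1
    push_cast
    ring
  rw [FD, abs_of_pos hs, key p, key q]
  ring

/-- The quotient `F(s) / s ^ 2` reaches the value `1 / 2`. -/
theorem exists_half_le_quotient {p q : ℝ} (hq : 1 < q) (hqp : q < p) :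
    ∃ s : ℝ, 0 ≤ s ∧ 1 / 2 ≤ |s| ^ (p - 1) / (p + 1) - |s| ^ (q - 1) / (q + 1) := by
  have hpq : 0 < p - q := sub_pos.mpr hqp
  have hp1 : 0 < p + 1 := by linarith
  have hq1 : 0 < q + 1 := by linarith
  set K : ℝ := (p + 1) * (1 / (q + 1) + 1 / 2) with hK
  have hK1 : 1 ≤ K := by
    have : 0 < 1 / (q + 1) := by positivity
    nlinarith
  set s : ℝ := K ^ (p - q)⁻¹ with hs
  have hs1 : 1 ≤ s := Real.one_le_rpow hK1 (inv_nonneg.mpr hpq.le)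
  have hs0 : 0 < s := by linarith
  have hsK : s ^ (p - q) = K := Real.rpow_inv_rpow (by linarith) hpq.ne'
  have hsq : 1 ≤ s ^ (q - 1) := Real.one_le_rpow hs1 (by linarith)
  refine ⟨s, hs0.le, ?_⟩
  have hsp : s ^ (p - 1) = s ^ (q - 1) * K := by
    rw [← hsK, ← Real.rpow_add hs0]
    congr 1
    ring
  have heq : s ^ (p - 1) / (p + 1) - s ^ (q - 1) / (q + 1) = s ^ (q - 1) / 2 := by
    rw [hsp, hK]
    field_simp
    ring
  rw [abs_of_pos hs0, heq]
  linarith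

theorem exists_smallest_zero (p q : ℝ) (hq : 1 < q) (hqp : q < p) :
    ∃ s₀ > (0 : ℝ), FD p q s₀ = s₀ ^ 2 / 2 ∧
      ∀ s ∈ Set.Ioo (0 : ℝ) s₀, FD p q s < s ^ 2 / 2 := by
  obtain ⟨b, hb0, hb⟩ := exists_half_le_quotient hq hqp
  have hpow : ∀ r : ℝ, 1 < r → Continuous fun s : ℝ => |s| ^ (r - 1) := fun r hr =>
    continuous_abs.rpow_const fun _ => Or.inr (by linarith)
  have hcont : Continuous fun s : ℝ =>
      |s| ^ (p - 1) / (p + 1) - |s| ^ (q - 1) / (q + 1) - 1 / 2 :=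
    (((hpow p (hq.trans hqp)).div_const _).sub ((hpow q hq).div_const _)).sub continuous_const
  obtain ⟨c, hc0, hc, hlt⟩ := exists_first_zero hcont hb0
    (by
      have h1 : p - 1 ≠ 0 := by linarith
      have h2 : q - 1 ≠ 0 := by linarith
      simp [Real.zero_rpow h1, Real.zero_rpow h2])
    (by linarith)
  refine ⟨c, hc0, ?_, fun s hs => ?_⟩
  · rw [FD_eq_sq_mul p q hc0, sub_eq_zero.mp hc]
    ring
  · rw [FD_eq_sq_mul p q hs.1]
    have h1 := hlt s hs
    have h2 : 0 < s ^ 2 := pow_pos hs.1 2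
    have h3 := mul_lt_mul_of_pos_left (sub_neg.mp h1) h2
    linarith
end

section
/- Let p, q be real numbers with 1 < q < p < ∞ and f'(s) = p|s|^{p−1} − q|s|^{q−1}. Let Q : ℝ → ℝ be continuous, let ν_0 ∈ ℝ, and let Y : ℝ → ℝ be twice continuously differentiable with −Y''(y) + Y(y) − f'(Q(y)) Y(y) = −ν_0² Y(y) for all y ∈ ℝ. Let ℓ ∈ (−1, 1), set a = 1/√(1 − ℓ²), μ = ℓ ν_0 a, and define Q_ℓ(x) = Q(ax), Y_ℓ(x) = Y(ax), Υ_1(x) = (ℓ Y_ℓ'(x) + ν_0 a Y_ℓ(x)) e^{μx} and Υ_2(x) = Y_ℓ(x) e^{μx}. Then for all x ∈ ℝ: (first component) −Υ_2''(x) + Υ_2(x) − f'(Q_ℓ(x)) Υ_2(x) + ℓ Υ_1'(x) = −ν_0 √(1 − ℓ²) Υ_1(x), and (second component) ℓ Υ_2'(x) − Υ_1(x) = −ν_0 √(1 − ℓ²) Υ_2(x). That is, Z⁺ = (Υ_1, Υ_2) satisfies 𝓗_ℓ J Z⁺ = −ν_0 √(1 − ℓ²) Z⁺. -/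
/-- Product rule for a function multiplied by the exponential weight `exp (μ x)`. -/
theorem HasDerivAt.mul_exp_const_mul {u : ℝ → ℝ} {u' x : ℝ} (hu : HasDerivAt u u' x) (μ : ℝ) :
    HasDerivAt (fun t => u t * Real.exp (μ * t)) ((u' + μ * u x) * Real.exp (μ * x)) x := by
  refine (hu.fun_mul ((hasDerivAt_id' x).const_mul μ).exp).congr_deriv ?_
  ring

/-- Chain rule for the dilation `x ↦ a x`. -/
theorem HasDerivAt.comp_const_mul {u : ℝ → ℝ} {u' a x : ℝ} (hu : HasDerivAt u u' (a * x)) :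
    HasDerivAt (fun t => u (a * t)) (a * u') x := by
  refine (hu.comp x ((hasDerivAt_id' x).const_mul a)).congr_deriv ?_
  ring


/-- The Lorentz-transformed unstable mode `Z⁺ = (Υ₁, Υ₂)` is an eigenfunction of the
matrix operator `𝓗ℓ J` with eigenvalue `-ν₀ √(1-ℓ²)`, where
`𝓗ℓ = [[-∂ₓ² + 1 - f'(Qℓ), -ℓ∂ₓ], [ℓ∂ₓ, 1]]` and `J = [[0,1],[-1,0]]`. -/
theorem eigenfunction_of_matrix_operator (p q : ℝ) (hq : 1 < q) (hqp : q < p)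
    (Q : ℝ → ℝ) (hQ : Continuous Q) (ν₀ : ℝ)
    (Y : ℝ → ℝ) (hY : ContDiff ℝ 2 Y)
    (heig : ∀ y : ℝ, -deriv (deriv Y) y + Y y - fD' p q (Q y) * Y y = -ν₀ ^ 2 * Y y)
    (ℓ : ℝ) (hℓ : ℓ ∈ Set.Ioo (-1 : ℝ) 1)
    (a μ : ℝ) (ha : a = 1 / Real.sqrt (1 - ℓ ^ 2)) (hμ : μ = ℓ * ν₀ * a)
    (Qℓ Yℓ Υ₁ Υ₂ : ℝ → ℝ)
    (hQℓ : ∀ x : ℝ, Qℓ x = Q (a * x))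
    (hYℓ : ∀ x : ℝ, Yℓ x = Y (a * x))
    (hΥ₁ : ∀ x : ℝ, Υ₁ x = (ℓ * deriv Yℓ x + ν₀ * a * Yℓ x) * Real.exp (μ * x))
    (hΥ₂ : ∀ x : ℝ, Υ₂ x = Yℓ x * Real.exp (μ * x)) :
    (∀ x : ℝ,
      -deriv (deriv Υ₂) x + Υ₂ x - fD' p q (Qℓ x) * Υ₂ x + ℓ * deriv Υ₁ x
        = -ν₀ * Real.sqrt (1 - ℓ ^ 2) * Υ₁ x) ∧
    (∀ x : ℝ,
      ℓ * deriv Υ₂ x - Υ₁ x = -ν₀ * Real.sqrt (1 - ℓ ^ 2) * Υ₂ x) := by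
  have hpos : 0 < 1 - ℓ ^ 2 := by nlinarith [hℓ.1, hℓ.2]
  have has : a * Real.sqrt (1 - ℓ ^ 2) = 1 := by
    rw [ha]
    exact one_div_mul_cancel (Real.sqrt_pos.2 hpos).ne'
  have hs : Real.sqrt (1 - ℓ ^ 2) = a * (1 - ℓ ^ 2) := by
    linear_combination (-Real.sqrt (1 - ℓ ^ 2)) * has + a * Real.sq_sqrt hpos.le
  rw [hs] at has ⊢
  have hY' (y : ℝ) : HasDerivAt Y (deriv Y y) y :=
    (hY.differentiable (by norm_num) y).hasDerivAt
  have hY'' (y : ℝ) : HasDerivAt (deriv Y) (deriv (deriv Y) y) y :=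
    (hY.differentiable_deriv_two y).hasDerivAt
  obtain rfl : Yℓ = fun x => Y (a * x) := funext hYℓ
  have hYℓ' : deriv (fun x => Y (a * x)) = fun x => a * deriv Y (a * x) :=
    funext fun x => (hY' (a * x)).comp_const_mul.deriv
  rw [hYℓ'] at hΥ₁
  obtain rfl := funext hΥ₁
  obtain rfl := funext hΥ₂
  have hΥ₂' : deriv (fun x => Y (a * x) * Real.exp (μ * x)) =
      fun x => (a * deriv Y (a * x) + μ * Y (a * x)) * Real.exp (μ * x) :=
    funext fun x => ((hY' (a * x)).comp_const_mul.mul_exp_const_mul μ).deriv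
  have hYd (x : ℝ) := (hY' (a * x)).comp_const_mul
  have hYdd (x : ℝ) := (hY'' (a * x)).comp_const_mul.const_mul a
  rw [hΥ₂']
  refine ⟨fun x => ?_, fun x => ?_⟩
  · beta_reduce
    rw [(((hYdd x).fun_add ((hYd x).const_mul μ)).mul_exp_const_mul μ).deriv,
      ((((hYdd x).const_mul ℓ).fun_add ((hYd x).const_mul (ν₀ * a))).mul_exp_const_mul μ).deriv, hQℓ]
    subst hμ
    linear_combination Real.exp (ℓ * ν₀ * a * x) * heig (a * x) -
      Real.exp (ℓ * ν₀ * a * x) * (deriv (deriv Y) (a * x) - ν₀ ^ 2 * Y (a * x)) * has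
  · subst hμ
    beta_reduce
    ring
end
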